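/- arXiv:1012.4255 — 2 statements merged into one kernel-verified Lean document; each statement's English description precedes it below -/
import Mathlib

section
/- Let μ be a probability measure on ℝ that is unimodal with some mode m, and let Z₁, Z₂ be independent random variables each with law μ. Then the law of Z₁ − Z₂ is symmetric about 0 and unimodal with mode 0. -/
open MeasureTheory ProbabilityTheory

/-- A probability measure on `ℝ` is unimodal with mode `m` if its cumulative distribution
function is convex on `(-∞, m]` and concave on `[m, ∞)`. -/
def IsUnimodalWithMode (μ : Measure ℝ) (m : ℝ) : Prop :=
  ConvexOn ℝ (Set.Iic m) (fun x => cdf μ x) ∧ ConcaveOn ℝ (Set.Ici m) (fun x => cdf μ x)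

/-- A measure on `ℝ` is symmetric about `0` if it equals its pushforward under `x ↦ -x`. -/
def IsSymmetricAboutZero (μ : Measure ℝ) : Prop :=
  μ.map (fun x => -x) = μ

lemma incr_aux {F : ℝ → ℝ} {s : Set ℝ} (hF : ConvexOn ℝ s F) {x y h : ℝ} (hxy : x ≤ y)
    (hh : 0 < h) (hx : x ∈ s) (hy : y + h ∈ s) : F (x + h) - F x ≤ F (y + h) - F y := by
  have hd : 0 < y + h - x := by linarith
  have h1 := hF.2 hx hy
    (div_nonneg (sub_nonneg.2 hxy) hd.le) (div_nonneg hh.le hd.le) (by field_simp; ring)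
  have h2 := hF.2 hx hy
    (div_nonneg hh.le hd.le) (div_nonneg (sub_nonneg.2 hxy) hd.le) (by field_simp; ring)
  simp only [smul_eq_mul] at h1 h2
  have e1 : (y - x) / (y + h - x) * x + h / (y + h - x) * (y + h) = x + h := by
    field_simp; ring
  have e2 : h / (y + h - x) * x + (y - x) / (y + h - x) * (y + h) = y := by
    field_simp; ring
  rw [e1] at h1
  rw [e2] at h2
  have e3 : (y - x) / (y + h - x) + h / (y + h - x) = 1 := by field_simp; ring
  have e4 : (y - x) / (y + h - x) = 1 - h / (y + h - x) := by linarith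
  rw [e4] at h1 h2
  linarith

lemma quasi_aux {F : ℝ → ℝ} {m : ℝ} (h1 : ConvexOn ℝ (Set.Iic m) F)
    (h2 : ConcaveOn ℝ (Set.Ici m) F) {h : ℝ} (hh : 0 < h) (u : ℝ) :
    Set.OrdConnected {x | u < F (x + h) - F x} := by
  have inc : ∀ x y, x ≤ y → y + h ≤ m → F (x + h) - F x ≤ F (y + h) - F y := fun x y hxy hy =>
    incr_aux h1 hxy hh (by simp only [Set.mem_Iic]; linarith) hy
  have dec : ∀ x y, x ≤ y → m ≤ x → F (y + h) - F y ≤ F (x + h) - F x := fun x y hxy hx => by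
    have := incr_aux h2.neg hxy hh hx (by simp only [Set.mem_Ici]; linarith)
    simp only [Pi.neg_apply] at this
    linarith
  have conc : ConcaveOn ℝ (Set.Icc (m - h) m) (fun x => F (x + h) - F x) := by
    have c1 : ConcaveOn ℝ (Set.Icc (m - h) m) (fun x => F (x + h)) :=
      (h2.translate_left h).subset (fun x hx => by
        simp only [Set.mem_preimage, Set.mem_Ici]; linarith [hx.1, hx.2]) (convex_Icc _ _)
    have c2 : ConvexOn ℝ (Set.Icc (m - h) m) F :=
      h1.subset (fun x hx => hx.2) (convex_Icc _ _)
    exact c1.sub c2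
  refine ⟨fun x hx z hz y hy => ?_⟩
  simp only [Set.mem_ofPred_eq] at *
  rcases le_total (y + h) m with c | c
  · linarith [inc x y hy.1 c]
  rcases le_total m y with c' | c'
  · linarith [dec y z hy.2 c']
  have hx' : u < F (max x (m - h) + h) - F (max x (m - h)) := by
    rcases le_total x (m - h) with d | d
    · rw [max_eq_right d]; linarith [inc x (m - h) d (by linarith)]
    · rw [max_eq_left d]; exact hx
  have hz' : u < F (min z m + h) - F (min z m) := by
    rcases le_total z m with d | d
    · rw [min_eq_left d]; exact hz
    · rw [min_eq_right d]; linarith [dec m z d le_rfl]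
  have k1 : max x (m - h) ≤ y := max_le hy.1 (by linarith)
  have k2 : y ≤ min z m := le_min hy.2 c'
  have := conc.min_le_of_mem_Icc (x := max x (m - h)) (y := min z m) (z := y)
    ⟨le_max_right _ _, by linarith [min_le_right z m]⟩
    ⟨by linarith [le_max_right x (m-h)], min_le_right _ _⟩ ⟨k1, k2⟩
  exact lt_of_lt_of_le (lt_min hx' hz') this

lemma overlap_aux {ψ : ℝ → ℝ} (hm : Measurable ψ)
    (hq : ∀ u, Set.OrdConnected {x | u < ψ x}) {s t : ℝ} (ht : 0 ≤ t) (hts : t ≤ s) :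
    ∫⁻ x, ENNReal.ofReal (ψ x) * ENNReal.ofReal (ψ (x + s)) ≤
      ∫⁻ x, ENNReal.ofReal (ψ x) * ENNReal.ofReal (ψ (x + t)) := by
  have key : ∀ t : ℝ, ∫⁻ x, ENNReal.ofReal (ψ x) * ENNReal.ofReal (ψ (x + t)) =
      ∫⁻ w : ℝ × ℝ, volume {x | (0 < w.1 ∧ w.1 < ψ x) ∧ (0 < w.2 ∧ w.2 < ψ (x + t))} := by
    intro t
    have hS : MeasurableSet {p : ℝ × (ℝ × ℝ) |
        (0 < p.2.1 ∧ p.2.1 < ψ p.1) ∧ (0 < p.2.2 ∧ p.2.2 < ψ (p.1 + t))} := by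
      simp only [Set.ofPred_and]
      refine ((measurableSet_lt ?_ ?_).inter (measurableSet_lt ?_ ?_)).inter
        ((measurableSet_lt ?_ ?_).inter (measurableSet_lt ?_ ?_)) <;> fun_prop
    have e1 := Measure.prod_apply (μ := (volume : Measure ℝ))
      (ν := (volume : Measure (ℝ × ℝ))) hS
    have e2 := Measure.prod_apply_symm (μ := (volume : Measure ℝ))
      (ν := (volume : Measure (ℝ × ℝ))) hS
    rw [e1] at e2
    refine Eq.trans ?_ e2
    refine lintegral_congr fun x => ?_
    have : (Prod.mk x ⁻¹' {p : ℝ × (ℝ × ℝ) |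
        (0 < p.2.1 ∧ p.2.1 < ψ p.1) ∧ (0 < p.2.2 ∧ p.2.2 < ψ (p.1 + t))}) =
        Set.Ioo 0 (ψ x) ×ˢ Set.Ioo 0 (ψ (x + t)) := by
      ext w; simp [Set.mem_prod]
    rw [this, Measure.volume_eq_prod, Measure.prod_prod]
    simp
  rw [key, key]
  refine lintegral_mono fun w => ?_
  obtain ⟨u, v⟩ := w
  simp only
  rcases le_total u v with huv | huv
  · -- the level set at v lies inside the one at u
    rw [← measure_preimage_add_right volume (t - s)
      {x | (0 < u ∧ u < ψ x) ∧ (0 < v ∧ v < ψ (x + s))}]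
    refine measure_mono fun x hx => ?_
    simp only [Set.mem_preimage, Set.mem_ofPred_eq] at hx ⊢
    obtain ⟨⟨a, b⟩, c, d⟩ := hx
    have e : x + (t - s) + s = x + t := by ring
    rw [e] at d
    exact ⟨⟨a, (hq u).out b (lt_of_le_of_lt huv d) ⟨by linarith, by linarith⟩⟩, c, d⟩
  · refine measure_mono fun x hx => ?_
    simp only [Set.mem_ofPred_eq] at hx ⊢
    obtain ⟨⟨a, b⟩, c, d⟩ := hx
    exact ⟨⟨a, b⟩, c, (hq v).out (lt_of_le_of_lt huv b) d ⟨by linarith, by linarith⟩⟩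

lemma conc_aux {a : ℝ → ENNReal} (ha : AntitoneOn a (Set.Ici 0)) {x y α β : ℝ}
    (hx : 0 ≤ x) (hxy : x ≤ y) (hα : 0 ≤ α) (hβ : 0 ≤ β) (hab : α + β = 1) :
    ENNReal.ofReal α * (∫⁻ r in Set.Ioc 0 x, a r) + ENNReal.ofReal β * (∫⁻ r in Set.Ioc 0 y, a r)
      ≤ ∫⁻ r in Set.Ioc 0 (α * x + β * y), a r := by
  set z := α * x + β * y with hz
  have hα' : α = 1 - β := by linarith
  have hxz : z - x = β * (y - x) := by rw [hz, hα']; ring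
  have hzy : y - z = α * (y - x) := by rw [hz, hα']; ring
  have hxz' : x ≤ z := by
    have := mul_nonneg hβ (sub_nonneg.2 hxy); linarith
  have hzy' : z ≤ y := by
    have := mul_nonneg hα (sub_nonneg.2 hxy); linarith
  have split : ∀ p q : ℝ, 0 ≤ p → p ≤ q → ∫⁻ r in Set.Ioc 0 q, a r =
      (∫⁻ r in Set.Ioc 0 p, a r) + ∫⁻ r in Set.Ioc p q, a r := by
    intro p q hp hpq
    rw [← lintegral_union measurableSet_Ioc (Set.Ioc_disjoint_Ioc_of_le le_rfl),
      Set.Ioc_union_Ioc_eq_Ioc hp hpq]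
  have s1 := split x z hx hxz'
  have s2 := split z y (hx.trans hxz') hzy'
  set A := ∫⁻ r in Set.Ioc 0 x, a r
  set I := ∫⁻ r in Set.Ioc x z, a r with hI
  set J := ∫⁻ r in Set.Ioc z y, a r with hJ
  have lI : a z * ENNReal.ofReal (β * (y - x)) ≤ I := by
    rw [← hxz, ← Real.volume_Ioc, ← setLIntegral_const]
    exact setLIntegral_mono' measurableSet_Ioc fun r hr =>
      ha (by simp only [Set.mem_Ici]; linarith [hr.1]) (by simp only [Set.mem_Ici]; linarith) hr.2
  have lJ : J ≤ a z * ENNReal.ofReal (α * (y - x)) := by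
    rw [← hzy, ← Real.volume_Ioc, ← setLIntegral_const]
    exact setLIntegral_mono' measurableSet_Ioc fun r hr =>
      ha (by simp only [Set.mem_Ici]; linarith) (by simp only [Set.mem_Ici]; linarith [hr.1])
        hr.1.le
  have lIJ : ENNReal.ofReal β * J ≤ ENNReal.ofReal α * I := by
    calc ENNReal.ofReal β * J ≤ ENNReal.ofReal β * (a z * ENNReal.ofReal (α * (y - x))) := by gcongr
      _ = ENNReal.ofReal α * (a z * ENNReal.ofReal (β * (y - x))) := by
        rw [ENNReal.ofReal_mul hα, ENNReal.ofReal_mul hβ]; ring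
      _ ≤ _ := by gcongr
  have one : ENNReal.ofReal α + ENNReal.ofReal β = 1 := by
    rw [← ENNReal.ofReal_add hα hβ, hab, ENNReal.ofReal_one]
  rw [s2, s1]
  calc ENNReal.ofReal α * A + ENNReal.ofReal β * (A + I + J)
      = (ENNReal.ofReal α + ENNReal.ofReal β) * A + (ENNReal.ofReal β * I + ENNReal.ofReal β * J) := by
        ring
    _ ≤ (ENNReal.ofReal α + ENNReal.ofReal β) * A + (ENNReal.ofReal β * I + ENNReal.ofReal α * I) := by
        gcongr
    _ = (ENNReal.ofReal α + ENNReal.ofReal β) * A + (ENNReal.ofReal α + ENNReal.ofReal β) * I := by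
        ring
    _ = A + I := by rw [one, one_mul, one_mul]

/-- Auxiliary set used to smooth the difference `z.2 - z.1`. -/
def smoothSet (h : ℝ) (z : ℝ × ℝ) : Set (ℝ × ℝ) :=
  {p | (p.2 < z.1 ∧ z.1 ≤ p.2 + h) ∧ (p.2 + (p.1 + h) < z.2 ∧ z.2 ≤ p.2 + (p.1 + h) + h)}

lemma measurableSet_smoothSet_aux (h : ℝ) :
    MeasurableSet {q : (ℝ × ℝ) × (ℝ × ℝ) | q.1 ∈ smoothSet h q.2} := by
  simp only [smoothSet, Set.ofPred_and]
  refine ((measurableSet_lt ?_ ?_).inter (measurableSet_le ?_ ?_)).inter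
        ((measurableSet_lt ?_ ?_).inter (measurableSet_le ?_ ?_)) <;> fun_prop

lemma measurableSet_smoothSet (h : ℝ) (z : ℝ × ℝ) : MeasurableSet (smoothSet h z) :=
  (measurable_id.prodMk measurable_const : Measurable fun p : ℝ × ℝ => (p, z))
    (measurableSet_smoothSet_aux h)

lemma volume_smoothSet (h : ℝ) (z : ℝ × ℝ) :
    volume (smoothSet h z) = ENNReal.ofReal h * ENNReal.ofReal h := by
  rw [Measure.volume_eq_prod, Measure.prod_apply_symm (measurableSet_smoothSet h z)]
  have : ∀ x : ℝ, volume ((fun r => (r, x)) ⁻¹' smoothSet h z) =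
      (Set.Ico (z.1 - h) z.1).indicator (fun _ => ENNReal.ofReal h) x := by
    intro x
    by_cases hx : x ∈ Set.Ico (z.1 - h) z.1
    · rw [Set.indicator_of_mem hx]
      have : (fun r => (r, x)) ⁻¹' smoothSet h z = Set.Ico (z.2 - x - h - h) (z.2 - x - h) := by
        ext r
        simp only [smoothSet, Set.mem_preimage, Set.mem_ofPred_eq, Set.mem_Ico] at hx ⊢
        constructor
        · rintro ⟨-, h1, h2⟩; constructor <;> linarith
        · rintro ⟨h1, h2⟩; refine ⟨⟨?_, ?_⟩, ?_, ?_⟩ <;> linarith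
      rw [this, Real.volume_Ico]
      congr 1; ring
    · rw [Set.indicator_of_notMem hx]
      have : (fun r => (r, x)) ⁻¹' smoothSet h z = ∅ := by
        ext r
        simp only [smoothSet, Set.mem_preimage, Set.mem_ofPred_eq, Set.mem_Ico,
          Set.mem_empty_iff_false, iff_false] at hx ⊢
        rintro ⟨⟨h1, h2⟩, -⟩
        exact hx ⟨by linarith, h1⟩
      rw [this, measure_empty]
  simp_rw [this]
  rw [lintegral_indicator measurableSet_Ico, setLIntegral_const, Real.volume_Ico]
  congr 2; ring

lemma lintegral_smooth (μ : Measure ℝ) [IsProbabilityMeasure μ] (h t : ℝ) :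
    ∫⁻ r in Set.Ioc 0 t, ∫⁻ x, ENNReal.ofReal (cdf μ (x + h) - cdf μ x) *
      ENNReal.ofReal (cdf μ (x + (r + h) + h) - cdf μ (x + (r + h))) =
    ∫⁻ z, volume ((Prod.fst ⁻¹' Set.Ioc 0 t) ∩ smoothSet h z) ∂(μ.prod μ) := by
  have hW : MeasurableSet {q : (ℝ × ℝ) × (ℝ × ℝ) | q.1.1 ∈ Set.Ioc 0 t ∧ q.1 ∈ smoothSet h q.2} := by
    rw [Set.ofPred_and]
    exact ((measurable_fst.comp measurable_fst) measurableSet_Ioc).inter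
      (measurableSet_smoothSet_aux h)
  have e1 := Measure.prod_apply (μ := (volume : Measure (ℝ × ℝ))) (ν := μ.prod μ) hW
  rw [Measure.prod_apply_symm hW] at e1
  refine Eq.trans ?_ e1.symm
  have hμ : ∀ a b, μ (Set.Ioc a b) = ENNReal.ofReal (cdf μ b - cdf μ a) := by
    intro a b
    conv_lhs => rw [← measure_cdf μ]
    exact StieltjesFunction.measure_Ioc _ _ _
  have hc : Measurable (cdf μ) := (monotone_cdf μ).measurable
  have : ∀ p : ℝ × ℝ, (μ.prod μ) (Prod.mk p ⁻¹' {q : (ℝ × ℝ) × (ℝ × ℝ) |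
      q.1.1 ∈ Set.Ioc 0 t ∧ q.1 ∈ smoothSet h q.2}) =
      (Set.Ioc 0 t).indicator (fun r => ENNReal.ofReal (cdf μ (p.2 + h) - cdf μ p.2) *
      ENNReal.ofReal (cdf μ (p.2 + (r + h) + h) - cdf μ (p.2 + (r + h)))) p.1 := by
    intro p
    by_cases hp : p.1 ∈ Set.Ioc 0 t
    · rw [Set.indicator_of_mem hp, ← hμ, ← hμ, ← Measure.prod_prod]
      congr 1
      ext z
      simp only [Set.mem_preimage, Set.mem_ofPred_eq, smoothSet, Set.mem_prod, Set.mem_Ioc]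
      exact and_iff_right hp
    · rw [Set.indicator_of_notMem hp]
      convert measure_empty (μ := μ.prod μ)
      exact Set.eq_empty_iff_forall_notMem.2 fun z hz => hp hz.1
  simp_rw [this]
  rw [Measure.volume_eq_prod, lintegral_prod]
  · rw [← lintegral_indicator measurableSet_Ioc]
    refine lintegral_congr fun r => ?_
    by_cases hr : r ∈ Set.Ioc 0 t
    · simp [Set.indicator_of_mem hr]
    · simp [Set.indicator_of_notMem hr]
  · simp_rw [← this]
    exact (measurable_measure_prodMk_left hW).aemeasurable

lemma tendsto_smooth (μ : Measure ℝ) [IsProbabilityMeasure μ] (t : ℝ) :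
    Filter.Tendsto (fun n : ℕ => ∫⁻ z, (volume (smoothSet (1 / ((n : ℝ) + 1)) 0))⁻¹ *
      volume ((Prod.fst ⁻¹' Set.Ioc 0 t) ∩ smoothSet (1 / ((n : ℝ) + 1)) z) ∂(μ.prod μ))
      Filter.atTop (nhds ((μ.prod μ) {z | z.2 - z.1 ∈ Set.Ioc 0 t})) := by
  have hD : MeasurableSet {z : ℝ × ℝ | z.2 - z.1 ∈ Set.Ioc 0 t} :=
    (measurable_snd.sub measurable_fst) measurableSet_Ioc
  have hv : ∀ (n : ℕ) (z : ℝ × ℝ), volume (smoothSet (1 / ((n : ℝ) + 1)) z) =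
      volume (smoothSet (1 / ((n : ℝ) + 1)) 0) := fun n z => by
    rw [volume_smoothSet, volume_smoothSet]
  have h0 : ∀ n : ℕ, volume (smoothSet (1 / ((n : ℝ) + 1)) 0) ≠ 0 := fun n => by
    rw [volume_smoothSet]
    have : 0 < 1 / ((n : ℝ) + 1) := by positivity
    simpa using this
  have hT : ∀ n : ℕ, volume (smoothSet (1 / ((n : ℝ) + 1)) 0) ≠ ⊤ := fun n => by
    rw [volume_smoothSet]
    exact ENNReal.mul_ne_top ENNReal.ofReal_ne_top ENNReal.ofReal_ne_top
  rw [← lintegral_indicator_one hD]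
  refine tendsto_lintegral_of_dominated_convergence (fun _ => 1) ?_ ?_ ?_ ?_
  · intro n
    refine Measurable.const_mul ?_ _
    have hW : MeasurableSet {q : (ℝ × ℝ) × (ℝ × ℝ) |
        q.1.1 ∈ Set.Ioc 0 t ∧ q.1 ∈ smoothSet (1 / ((n : ℝ) + 1)) q.2} := by
      rw [Set.ofPred_and]
      exact ((measurable_fst.comp measurable_fst) measurableSet_Ioc).inter
        (measurableSet_smoothSet_aux _)
    exact measurable_measure_prodMk_right hW
  · intro n
    refine Filter.Eventually.of_forall fun z => ?_
    simp only
    calc _ ≤ (volume (smoothSet (1 / ((n : ℝ) + 1)) 0))⁻¹ *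
          volume (smoothSet (1 / ((n : ℝ) + 1)) z) := by gcongr; exact Set.inter_subset_right
      _ = 1 := by rw [hv n z, ENNReal.inv_mul_cancel (h0 n) (hT n)]
  · simp
  · refine Filter.Eventually.of_forall fun z => ?_
    have hlim : Filter.Tendsto (fun n : ℕ => 1 / ((n : ℝ) + 1)) Filter.atTop (nhds 0) :=
      tendsto_one_div_add_atTop_nhds_zero_nat
    by_cases hz : z ∈ {z : ℝ × ℝ | z.2 - z.1 ∈ Set.Ioc 0 t}
    · rw [Set.indicator_of_mem hz]
      have hz' : 0 < z.2 - z.1 ∧ z.2 - z.1 ≤ t := hz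
      refine tendsto_const_nhds.congr' ?_
      have := hlim.eventually (gt_mem_nhds (b := (0 : ℝ)) (a := (z.2 - z.1) / 2) (by linarith))
      filter_upwards [this] with n hn
      have : (Prod.fst ⁻¹' Set.Ioc 0 t) ∩ smoothSet (1 / ((n : ℝ) + 1)) z =
          smoothSet (1 / ((n : ℝ) + 1)) z := by
        refine Set.inter_eq_right.2 fun p hp => ?_
        obtain ⟨⟨a, b⟩, c, d⟩ := hp
        exact ⟨by linarith, by linarith⟩
      rw [this, hv n z, ENNReal.inv_mul_cancel (h0 n) (hT n)]
      rfl
    · rw [Set.indicator_of_notMem hz]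
      refine tendsto_const_nhds.congr' ?_
      have hz' : ¬ (0 < z.2 - z.1 ∧ z.2 - z.1 ≤ t) := hz
      have key : ∀ᶠ n : ℕ in Filter.atTop,
          (Prod.fst ⁻¹' Set.Ioc 0 t) ∩ smoothSet (1 / ((n : ℝ) + 1)) z = ∅ := by
        rcases le_or_gt (z.2 - z.1) 0 with hl | hl
        · refine Filter.Eventually.of_forall fun n => ?_
          refine Set.eq_empty_iff_forall_notMem.2 fun p hp => ?_
          obtain ⟨⟨e, f⟩, ⟨a, b⟩, c, d⟩ := hp
          linarith
        · have hl' : t < z.2 - z.1 := by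
            by_contra hcon
            exact hz' ⟨hl, not_lt.1 hcon⟩
          have := hlim.eventually (gt_mem_nhds (b := (0 : ℝ)) (a := (z.2 - z.1 - t) / 2) (by linarith))
          filter_upwards [this] with n hn
          refine Set.eq_empty_iff_forall_notMem.2 fun p hp => ?_
          obtain ⟨⟨e, f⟩, ⟨a, b⟩, c, d⟩ := hp
          linarith
      filter_upwards [key] with n hn
      rw [hn, measure_empty, mul_zero]

lemma conc_prod (μ : Measure ℝ) [IsProbabilityMeasure μ] (m : ℝ) (hμ : IsUnimodalWithMode μ m)
    {x y α β : ℝ} (hx : 0 ≤ x) (hxy : x ≤ y) (hα : 0 ≤ α) (hβ : 0 ≤ β) (hab : α + β = 1) :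
    ENNReal.ofReal α * (μ.prod μ) {z | z.2 - z.1 ∈ Set.Ioc 0 x} +
      ENNReal.ofReal β * (μ.prod μ) {z | z.2 - z.1 ∈ Set.Ioc 0 y} ≤
      (μ.prod μ) {z | z.2 - z.1 ∈ Set.Ioc 0 (α * x + β * y)} := by
  refine le_of_tendsto_of_tendsto'
    ((ENNReal.Tendsto.const_mul (tendsto_smooth μ x) (Or.inr ENNReal.ofReal_ne_top)).add
    (ENNReal.Tendsto.const_mul (tendsto_smooth μ y) (Or.inr ENNReal.ofReal_ne_top)))
    (tendsto_smooth μ _) fun n => ?_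
  set h : ℝ := 1 / ((n : ℝ) + 1) with hh
  have hpos : 0 < h := by positivity
  have hT : (volume (smoothSet h 0))⁻¹ ≠ ⊤ := by
    rw [volume_smoothSet]
    simpa using hpos
  rw [lintegral_const_mul' _ _ hT, lintegral_const_mul' _ _ hT, lintegral_const_mul' _ _ hT,
    ← lintegral_smooth, ← lintegral_smooth, ← lintegral_smooth]
  have hc : Measurable (cdf μ) := (monotone_cdf μ).measurable
  have anti : AntitoneOn (fun r : ℝ => ∫⁻ x, ENNReal.ofReal (cdf μ (x + h) - cdf μ x) *
      ENNReal.ofReal (cdf μ (x + (r + h) + h) - cdf μ (x + (r + h)))) (Set.Ici 0) := by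
    intro r hr s hs hrs
    have hr' : 0 ≤ r := hr
    exact overlap_aux (ψ := fun x => cdf μ (x + h) - cdf μ x) (by fun_prop)
      (fun u => quasi_aux hμ.1 hμ.2 hpos u) (by linarith) (by linarith)
  have := conc_aux anti hx hxy hα hβ hab
  calc _ = (volume (smoothSet h 0))⁻¹ * _ := by
        rw [mul_left_comm, mul_left_comm (ENNReal.ofReal β), ← mul_add]
    _ ≤ _ := mul_le_mul_right this _

lemma concave_of_conc (ν : Measure ℝ) [IsProbabilityMeasure ν]
    (H : ∀ x y α β : ℝ, 0 ≤ x → x ≤ y → 0 ≤ α → 0 ≤ β → α + β = 1 →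
      ENNReal.ofReal α * ν (Set.Ioc 0 x) + ENNReal.ofReal β * ν (Set.Ioc 0 y) ≤
      ν (Set.Ioc 0 (α * x + β * y))) : ConcaveOn ℝ (Set.Ici 0) (fun x => cdf ν x) := by
  have hμ : ∀ b, ν (Set.Ioc 0 b) = ENNReal.ofReal (cdf ν b - cdf ν 0) := by
    intro b
    conv_lhs => rw [← measure_cdf ν]
    exact StieltjesFunction.measure_Ioc _ _ _
  have H' : ∀ x y α β : ℝ, 0 ≤ x → x ≤ y → 0 ≤ α → 0 ≤ β → α + β = 1 →
      α * cdf ν x + β * cdf ν y ≤ cdf ν (α * x + β * y) := by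
    intro x y α β hx hxy hα hβ hab
    have := H x y α β hx hxy hα hβ hab
    have n1 : 0 ≤ cdf ν x - cdf ν 0 := sub_nonneg.2 (monotone_cdf ν hx)
    have n2 : 0 ≤ cdf ν y - cdf ν 0 := sub_nonneg.2 (monotone_cdf ν (hx.trans hxy))
    have n3 : 0 ≤ cdf ν (α * x + β * y) - cdf ν 0 := sub_nonneg.2 (monotone_cdf ν
      (add_nonneg (mul_nonneg hα hx) (mul_nonneg hβ (hx.trans hxy))))
    rw [hμ, hμ, hμ, ← ENNReal.ofReal_mul hα, ← ENNReal.ofReal_mul hβ,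
      ← ENNReal.ofReal_add (mul_nonneg hα n1) (mul_nonneg hβ n2),
      ENNReal.ofReal_le_ofReal_iff n3] at this
    have e : α = 1 - β := by linarith
    rw [e] at this ⊢
    linarith
  refine ⟨convex_Ici _, fun x hx y hy α β hα hβ hab => ?_⟩
  simp only [smul_eq_mul]
  rcases le_total x y with h | h
  · exact H' x y α β hx h hα hβ hab
  · have := H' y x β α hy h hβ hα (by linarith)
    rw [add_comm (α * x), add_comm (α * cdf ν x)]
    exact this

lemma convex_of_symm (ν : Measure ℝ) [IsProbabilityMeasure ν]
    (hs : IsSymmetricAboutZero ν) (hc : ConcaveOn ℝ (Set.Ici 0) (fun x => cdf ν x)) :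
    ConvexOn ℝ (Set.Iic 0) (fun x => cdf ν x) := by
  have hrefl : ∀ x, cdf ν x = 1 - ν.real (Set.Iio (-x)) := by
    intro x
    rw [cdf_eq_real, ← probReal_compl_eq_one_sub measurableSet_Iio]
    conv_lhs => rw [← hs]
    rw [map_measureReal_apply measurable_neg measurableSet_Iic]
    congr 1
    ext y
    simp
  have hge : ∀ x, 1 - cdf ν (-x) ≤ cdf ν x := by
    intro x
    rw [hrefl x, cdf_eq_real]
    have : ν.real (Set.Iio (-x)) ≤ ν.real (Set.Iic (-x)) :=
      measureReal_mono Set.Iio_subset_Iic_self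
    linarith
  have heq : ∀ x, x < 0 → cdf ν x = 1 - cdf ν (-x) := by
    intro x hx
    have hcont : ContinuousAt (cdf ν) (-x) := by
      have := hc.continuousOn_interior
      rw [interior_Ici] at this
      exact this.continuousAt (Ioi_mem_nhds (by linarith))
    rw [hrefl x]
    congr 1
    have h0 : ν {-x} = 0 := by
      conv_lhs => rw [← measure_cdf ν]
      rw [StieltjesFunction.measure_singleton, ContinuousWithinAt.leftLim_eq
        hcont.continuousWithinAt]
      simp
    rw [cdf_eq_real, measureReal_def, measureReal_def]
    congr 1
    have : Set.Iic (-x) = Set.Iio (-x) ∪ {-x} := by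
      ext y; simp [le_iff_lt_or_eq, or_comm]
    rw [this]
    refine le_antisymm (measure_mono Set.subset_union_left) ?_
    exact (measure_union_le _ _).trans (by rw [h0, add_zero])
  refine convexOn_iff_forall_pos.2 ⟨convex_Iic _, fun x hx y hy α β hα hβ hab => ?_⟩
  have hx' : x ≤ 0 := hx
  have hy' : y ≤ 0 := hy
  simp only [smul_eq_mul]
  have k1 := mul_nonneg hα.le (neg_nonneg.2 hx')
  have k2 := mul_nonneg hβ.le (neg_nonneg.2 hy')
  rcases eq_or_lt_of_le (show α * x + β * y ≤ 0 by linarith) with hz | hz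
  · have hx0 : x = 0 := by
      by_contra hne
      have : 0 < α * (-x) := mul_pos hα (neg_pos.2 (lt_of_le_of_ne hx' hne))
      linarith
    have hy0 : y = 0 := by
      by_contra hne
      have : 0 < β * (-y) := mul_pos hβ (neg_pos.2 (lt_of_le_of_ne hy' hne))
      linarith
    subst hx0 hy0
    simp only [mul_zero, add_zero]
    rw [← add_mul, hab, one_mul]
  · rw [heq _ hz]
    have := hc.2 (x := -x) (y := -y) (neg_nonneg.2 hx') (neg_nonneg.2 hy') hα.le hβ.le hab
    simp only [smul_eq_mul] at this
    have e : α * -x + β * -y = -(α * x + β * y) := by ring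
    rw [e] at this
    have g1 := mul_le_mul_of_nonneg_left (hge x) hα.le
    have g2 := mul_le_mul_of_nonneg_left (hge y) hβ.le
    linarith

/-- **The difference of two i.i.d. random variables with a unimodal law is symmetric about `0`
and unimodal with mode `0`.** -/
theorem law_sub_indep_unimodal_symm_unimodal
    {Ω : Type*} [MeasurableSpace Ω] (P : Measure Ω) [IsProbabilityMeasure P]
    (μ : Measure ℝ) [IsProbabilityMeasure μ] (m : ℝ) (hμ : IsUnimodalWithMode μ m)
    (Z₁ Z₂ : Ω → ℝ) (hZ₁ : Measurable Z₁) (hZ₂ : Measurable Z₂)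
    (hindep : IndepFun Z₁ Z₂ P)
    (hlaw₁ : P.map Z₁ = μ) (hlaw₂ : P.map Z₂ = μ) :
    IsSymmetricAboutZero (P.map (fun ω => Z₁ ω - Z₂ ω)) ∧
      IsUnimodalWithMode (P.map (fun ω => Z₁ ω - Z₂ ω)) 0 := by
  have hD : ∀ X Y : Ω → ℝ, Measurable X → Measurable Y → IndepFun X Y P → P.map X = μ →
      P.map Y = μ → P.map (fun ω => X ω - Y ω) = (μ.prod μ).map (fun z => z.1 - z.2) := by
    intro X Y hX hY hi hlX hlY
    have h1 := (indepFun_iff_map_prod_eq_prod_map_map hX.aemeasurable hY.aemeasurable).1 hi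
    rw [hlX, hlY] at h1
    rw [← h1, Measure.map_map (by fun_prop) (by fun_prop)]
    rfl
  have e1 := hD Z₁ Z₂ hZ₁ hZ₂ hindep hlaw₁ hlaw₂
  have e2 := hD Z₂ Z₁ hZ₂ hZ₁ hindep.symm hlaw₂ hlaw₁
  have hsym : IsSymmetricAboutZero (P.map (fun ω => Z₁ ω - Z₂ ω)) := by
    unfold IsSymmetricAboutZero
    rw [Measure.map_map (by fun_prop) (by fun_prop), e1, ← e2]
    congr 1
    ext ω
    simp
  have : IsProbabilityMeasure (P.map (fun ω => Z₁ ω - Z₂ ω)) :=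
    Measure.isProbabilityMeasure_map (by fun_prop)
  have e3 : P.map (fun ω => Z₁ ω - Z₂ ω) = (μ.prod μ).map (fun z => z.2 - z.1) := by
    rw [e1]
    conv_lhs => rw [← Measure.prod_swap]
    rw [Measure.map_map (by fun_prop) (by fun_prop)]
    rfl
  have hconc : ConcaveOn ℝ (Set.Ici 0) (fun x => cdf (P.map (fun ω => Z₁ ω - Z₂ ω)) x) := by
    refine concave_of_conc _ fun x y α β hx hxy hα hβ hab => ?_
    rw [e3, Measure.map_apply (by fun_prop) measurableSet_Ioc,
      Measure.map_apply (by fun_prop) measurableSet_Ioc,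
      Measure.map_apply (by fun_prop) measurableSet_Ioc]
    exact conc_prod μ m hμ hx hxy hα hβ hab
  exact ⟨hsym, convex_of_symm _ hsym hconc, hconc⟩
end

section
/- Let K ≥ 1, let π₁,…,π_K ≥ 0 with Σ_{i=1}^K π_i = 1, and let μ₁,…,μ_K be probability measures on ℝ such that each μ_i is unimodal with some mode m_i. Let ε₁, ε₂ be independent random variables each with law μ = Σ_{i=1}^K π_i μ_i. Then there exist probability measures ν₀ and ν₁ on ℝ, with ν₀ symmetric about 0 and unimodal with mode 0 and ν₁ symmetric about 0, such that the law of ε₁ − ε₂ equals π₀ ν₀ + (1 − π₀) ν₁, where π₀ = Σ_{i=1}^K π_i² ≥ 1/K. -/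
open MeasureTheory ProbabilityTheory

lemma aux_local_density (μ : Measure ℝ) [IsProbabilityMeasure μ] (S : Set ℝ) (hS : IsOpen S)
    (f : ℝ → ℝ) (hc : ContinuousOn (fun x => cdf μ x) S)
    (hd : ∀ x ∈ S, HasDerivWithinAt (fun x => cdf μ x) (f x) (Set.Ioi x) x)
    (hf0 : ∀ x, 0 ≤ f x)
    (hint : ∀ a b, Set.Icc a b ⊆ S → IntegrableOn f (Set.Icc a b)) :
    μ.restrict S = (volume.withDensity (fun x => ENNReal.ofReal (f x))).restrict S := by
  have key : ∀ a b, a ≤ b → Set.Icc a b ⊆ S →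
      μ (Set.Ioc a b) = (volume.withDensity (fun x => ENNReal.ofReal (f x))) (Set.Ioc a b) := by
    intro a b hab hs
    have h1 := intervalIntegral.integral_eq_sub_of_hasDeriv_right_of_le_real hab (hc.mono hs)
      (fun x hx => hd x (hs (Set.Ioo_subset_Icc_self hx))) (hint a b hs)
    rw [withDensity_apply _ measurableSet_Ioc, ← ofReal_integral_eq_lintegral_ofReal
      ((hint a b hs).mono_set Set.Ioc_subset_Icc_self) (Filter.Eventually.of_forall hf0),
      ← intervalIntegral.integral_of_le hab, h1, ← StieltjesFunction.measure_Ioc, measure_cdf]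
  have hU : S = ⋃ (p : {p : ℚ × ℚ // Set.Icc (p.1 : ℝ) p.2 ⊆ S}),
      Set.Ioc (p.1.1 : ℝ) p.1.2 := by
    ext x
    constructor
    · intro hx
      obtain ⟨l, u, hlu, hs⟩ := mem_nhds_iff_exists_Ioo_subset.1 (hS.mem_nhds hx)
      obtain ⟨p, hp1, hp2⟩ := exists_rat_btwn hlu.1
      obtain ⟨q, hq1, hq2⟩ := exists_rat_btwn hlu.2
      refine Set.mem_iUnion.2 ⟨⟨(p, q), fun y hy => hs ⟨hp1.trans_le hy.1, hy.2.trans_lt hq2⟩⟩,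
        hp2, hq1.le⟩
    · intro hx
      obtain ⟨p, hp⟩ := Set.mem_iUnion.1 hx
      exact p.2 (Set.Ioc_subset_Icc_self hp)
  rw [hU, Measure.restrict_iUnion_congr]
  rintro ⟨⟨p, q⟩, hpq⟩
  apply Measure.ext_of_Ioc
  intro a b hab
  rw [Measure.restrict_apply measurableSet_Ioc, Measure.restrict_apply measurableSet_Ioc,
    Set.Ioc_inter_Ioc]
  rcases le_total (max a (p : ℝ)) (min b (q : ℝ)) with h | h
  · exact key _ _ h ((Set.Icc_subset_Icc (le_max_right _ _) (min_le_right _ _)).trans hpq)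
  · simp only [Set.Ioc_eq_empty_of_le h, measure_empty]

lemma aux_forward (μ : Measure ℝ) [IsProbabilityMeasure μ] (m : ℝ) (h : IsUnimodalWithMode μ m) :
    ∃ φ : ℝ → ENNReal, MonotoneOn φ (Set.Iic m) ∧ AntitoneOn φ (Set.Ici m) ∧
      μ = μ {m} • Measure.dirac m + volume.withDensity φ := by
  obtain ⟨hcv, hcc⟩ := h
  set F : ℝ → ℝ := fun x => cdf μ x with hF
  have hmono : Monotone F := monotone_cdf μ
  set f : ℝ → ℝ := fun x => derivWithin F (Set.Ioi x) x with hf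
  have hf0 : ∀ x, 0 ≤ f x := fun x => (hmono.monotoneOn _).derivWithin_nonneg
  have hcn : ConvexOn ℝ (Set.Ici m) (-F) := hcc.neg
  have hfn : ∀ x, derivWithin (-F) (Set.Ioi x) x = - f x := fun x => derivWithin.neg
  have hm1 : MonotoneOn f (Set.Iio m) := by
    have := hcv.monotoneOn_rightDeriv
    rwa [interior_Iic] at this
  have hm2 : AntitoneOn f (Set.Ioi m) := by
    have := hcn.monotoneOn_rightDeriv
    rw [interior_Ici] at this
    intro x hx y hy hxy
    have h3 := this hx hy hxy
    simp only [hfn] at h3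
    linarith
  have d1 : ∀ x ∈ Set.Iio m, HasDerivWithinAt F (f x) (Set.Ioi x) x := fun x hx =>
    hcv.hasDerivWithinAt_rightDeriv_of_mem_interior (by rwa [interior_Iic])
  have d2 : ∀ x ∈ Set.Ioi m, HasDerivWithinAt F (f x) (Set.Ioi x) x := fun x hx => by
    have := (hcn.hasDerivWithinAt_rightDeriv_of_mem_interior (x := x) (by rwa [interior_Ici])).neg
    rw [hfn] at this
    simpa using this
  have c1 : ContinuousOn F (Set.Iio m) := by
    have := hcv.continuousOn_interior; rwa [interior_Iic] at this
  have c2 : ContinuousOn F (Set.Ioi m) := by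
    have := hcc.continuousOn_interior; rwa [interior_Ici] at this
  have r1 := aux_local_density μ (Set.Iio m) isOpen_Iio f c1 d1 hf0
    (fun a b hs => (hm1.mono hs).integrableOn_isCompact isCompact_Icc)
  have r2 := aux_local_density μ (Set.Ioi m) isOpen_Ioi f c2 d2 hf0
    (fun a b hs => (hm2.mono hs).integrableOn_isCompact isCompact_Icc)
  refine ⟨fun x => if x = m then ⊤ else ENNReal.ofReal (f x), ?_, ?_, ?_⟩
  · intro x hx y hy hxy
    by_cases hy' : y = m
    · simp [hy']
    have hy2 : y < m := lt_of_le_of_ne hy hy'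
    have hx2 : x < m := hxy.trans_lt hy2
    simp only [hx2.ne, hy2.ne, if_false]
    exact ENNReal.ofReal_le_ofReal (hm1 hx2 hy2 hxy)
  · intro x hx y hy hxy
    by_cases hx' : x = m
    · simp [hx']
    have hx2 : m < x := lt_of_le_of_ne hx (Ne.symm hx')
    have hy2 : m < y := hx2.trans_le hxy
    simp only [hx2.ne', hy2.ne', if_false]
    exact ENNReal.ofReal_le_ofReal (hm2 hx2 hy2 hxy)
  · have e1 : volume.withDensity (fun x => if x = m then ⊤ else ENNReal.ofReal (f x))
        = volume.withDensity (fun x => ENNReal.ofReal (f x)) := by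
      apply withDensity_congr_ae
      have : ∀ᵐ x : ℝ, x ≠ m := by
        rw [ae_iff]; simp
      filter_upwards [this] with x hx
      simp [hx]
    rw [e1]
    have r3 : μ.restrict {m}ᶜ
        = (volume.withDensity (fun x => ENNReal.ofReal (f x))).restrict {m}ᶜ := by
      rw [← Set.Iio_union_Ioi, Measure.restrict_union_congr]
      exact ⟨r1, r2⟩
    have r4 : (volume.withDensity (fun x => ENNReal.ofReal (f x))).restrict {m}ᶜ
        = volume.withDensity (fun x => ENNReal.ofReal (f x)) := by
      rw [Measure.restrict_eq_self_of_ae_mem]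
      apply (withDensity_absolutelyContinuous volume _).ae_le
      change ∀ᵐ x : ℝ, x ≠ m
      rw [ae_iff]; simp
    rw [← r4, ← r3, ← Measure.restrict_singleton,
      Measure.restrict_add_restrict_compl (measurableSet_singleton m)]

lemma aux_backward (ρ : Measure ℝ) [IsProbabilityMeasure ρ] (c : ENNReal) (h : ℝ → ENNReal)
    (h1 : MonotoneOn h (Set.Iio 0)) (h2 : AntitoneOn h (Set.Ioi 0))
    (hρ : ρ = c • Measure.dirac 0 + volume.withDensity h) : IsUnimodalWithMode ρ 0 := by
  have hdiff : ∀ x y, x ≤ y → cdf ρ y - cdf ρ x = ρ.real (Set.Ioc x y) := by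
    intro x y hxy
    have := measure_cdf ρ
    rw [measureReal_def]
    nth_rw 3 [← this]
    rw [StieltjesFunction.measure_Ioc, ENNReal.toReal_ofReal]
    linarith [monotone_cdf ρ hxy]
  have hge : ∀ s, MeasurableSet s → ∫⁻ t in s, h t ≤ ρ s := by
    intro s hs
    conv_rhs => rw [hρ]
    rw [Measure.add_apply, withDensity_apply _ hs]
    exact le_add_self
  have heq : ∀ s, MeasurableSet s → (0 : ℝ) ∉ s → ρ s = ∫⁻ t in s, h t := by
    intro s hs h0
    conv_lhs => rw [hρ]
    rw [Measure.add_apply, withDensity_apply _ hs]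
    simp [h0]
  -- lower and upper bounds
  have lower : ∀ x y v, x < y → (∀ t ∈ Set.Ioo x y, v ≤ h t) →
      v ≠ ⊤ ∧ v.toReal * (y - x) ≤ ρ.real (Set.Ioc x y) := by
    intro x y v hxy hv
    have b : v * ENNReal.ofReal (y - x) ≤ ρ (Set.Ioc x y) := by
      calc v * ENNReal.ofReal (y - x) = ∫⁻ t in Set.Ioo x y, v := by simp
        _ ≤ ∫⁻ t in Set.Ioo x y, h t := setLIntegral_mono' measurableSet_Ioo hv
        _ ≤ ρ (Set.Ioo x y) := hge _ measurableSet_Ioo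
        _ ≤ _ := measure_mono Set.Ioo_subset_Ioc_self
    have hpos : 0 < y - x := by linarith
    constructor
    · rintro rfl
      rw [ENNReal.top_mul (by simpa using hxy)] at b
      exact (measure_ne_top ρ _) (top_le_iff.1 b)
    · have := ENNReal.toReal_mono (measure_ne_top ρ _) b
      rwa [ENNReal.toReal_mul, ENNReal.toReal_ofReal hpos.le] at this
  have upper : ∀ x y v, x < y → v ≠ ⊤ → (0 : ℝ) ∉ Set.Ioc x y → (∀ t ∈ Set.Ioc x y, h t ≤ v) →
      ρ.real (Set.Ioc x y) ≤ v.toReal * (y - x) := by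
    intro x y v hxy hvt h0 hv
    have hpos : 0 < y - x := by linarith
    have b : ρ (Set.Ioc x y) ≤ v * ENNReal.ofReal (y - x) := by
      rw [heq _ measurableSet_Ioc h0]
      calc _ ≤ ∫⁻ t in Set.Ioc x y, v := setLIntegral_mono' measurableSet_Ioc hv
        _ = _ := by simp
    have := ENNReal.toReal_mono (ENNReal.mul_ne_top hvt ENNReal.ofReal_ne_top) b
    rwa [ENNReal.toReal_mul, ENNReal.toReal_ofReal hpos.le] at this
  constructor
  · refine convexOn_of_slope_mono_adjacent (convex_Iic 0) ?_
    intro x y z hx hz hxy hyz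
    have hz' : z ≤ 0 := hz
    have hy : y < 0 := hyz.trans_le hz'
    obtain ⟨l1, l2⟩ := lower y z (h y) hyz
      (fun t ht => h1 hy (ht.2.trans_le hz') ht.1.le)
    have u := upper x y (h y) hxy l1 (fun h0 => absurd h0.2 (not_le.2 hy))
      (fun t ht => h1 (ht.2.trans_lt hy) hy ht.2)
    rw [hdiff x y hxy.le, hdiff y z hyz.le]
    exact ((div_le_iff₀ (by linarith)).2 u).trans ((le_div_iff₀ (by linarith)).2 l2)
  · refine concaveOn_of_slope_anti_adjacent (convex_Ici 0) ?_
    intro x y z hx hz hxy hyz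
    have hx' : 0 ≤ x := hx
    have hy : 0 < y := hx'.trans_lt hxy
    obtain ⟨l1, l2⟩ := lower x y (h y) hxy
      (fun t ht => h2 (hx'.trans_lt ht.1) hy ht.2.le)
    have u := upper y z (h y) hyz l1 (fun h0 => absurd h0.1 (not_lt.2 hy.le))
      (fun t ht => h2 hy (hy.trans ht.1) ht.1.le)
    rw [hdiff x y hxy.le, hdiff y z hyz.le]
    exact ((div_le_iff₀ (by linarith)).2 u).trans ((le_div_iff₀ (by linarith)).2 l2)

lemma aux_ordConnected (φ : ℝ → ENNReal) (m : ℝ) (h1 : MonotoneOn φ (Set.Iic m))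
    (h2 : AntitoneOn φ (Set.Ici m)) (s : ENNReal) : Set.OrdConnected {x | s < φ x} := by
  refine ⟨fun x hx y hy z hz => ?_⟩
  rcases le_total z m with h | h
  · exact lt_of_lt_of_le hx (h1 (hz.1.trans h) h hz.1)
  · exact lt_of_lt_of_le hy (h2 h (h.trans hz.2) hz.2)

lemma aux_layer (v : ENNReal) : (volume.restrict (Set.Ioi (0:ℝ))) {s | ENNReal.ofReal s < v} = v := by
  have hm : MeasurableSet {s : ℝ | ENNReal.ofReal s < v} :=
    measurableSet_lt (by fun_prop) measurable_const
  rw [Measure.restrict_apply hm]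
  by_cases hv : v = ⊤
  · subst hv
    simp
  · have : {s : ℝ | ENNReal.ofReal s < v} ∩ Set.Ioi 0 = Set.Ioo 0 v.toReal := by
      ext s
      simp only [Set.mem_inter_iff, Set.mem_ofPred_eq, Set.mem_Ioi, Set.mem_Ioo]
      constructor
      · rintro ⟨a, b⟩
        exact ⟨b, (ENNReal.ofReal_lt_iff_lt_toReal b.le hv).1 a⟩
      · rintro ⟨b, a⟩
        exact ⟨(ENNReal.ofReal_lt_iff_lt_toReal b.le hv).2 a, b⟩
    rw [this, Real.volume_Ioo, sub_zero, ENNReal.ofReal_toReal hv]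

lemma aux_g_eq (φ : ℝ → ENNReal) (hφ : Measurable φ) (t : ℝ) :
    ∫⁻ y, φ y * φ (y + t) = ∫⁻ p : ℝ × ℝ, volume {y : ℝ | ENNReal.ofReal p.1 < φ y ∧
      ENNReal.ofReal p.2 < φ (y + t)}
      ∂((volume.restrict (Set.Ioi (0:ℝ))).prod (volume.restrict (Set.Ioi (0:ℝ)))) := by
  set ν := (volume.restrict (Set.Ioi (0:ℝ))).prod (volume.restrict (Set.Ioi (0:ℝ)))
  let T : Set (ℝ × (ℝ × ℝ)) := {q | ENNReal.ofReal q.2.1 < φ q.1 ∧ ENNReal.ofReal q.2.2 < φ (q.1 + t)}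
  have hT1 : MeasurableSet {q : ℝ × (ℝ × ℝ) | ENNReal.ofReal q.2.1 < φ q.1} :=
    measurableSet_lt (by fun_prop) (by fun_prop)
  have hT2 : MeasurableSet {q : ℝ × (ℝ × ℝ) | ENNReal.ofReal q.2.2 < φ (q.1 + t)} :=
    measurableSet_lt (by fun_prop) (by fun_prop)
  have hT : MeasurableSet T := hT1.inter hT2
  have e1 := Measure.prod_apply (μ := (volume : Measure ℝ)) (ν := ν) hT
  have e2 := Measure.prod_apply_symm (μ := (volume : Measure ℝ)) (ν := ν) hT
  rw [e1] at e2
  refine Eq.trans (lintegral_congr fun y => ?_) e2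
  have : Prod.mk y ⁻¹' T = {s | ENNReal.ofReal s < φ y} ×ˢ {s | ENNReal.ofReal s < φ (y + t)} := by
    ext p; rfl
  rw [this, Measure.prod_prod, aux_layer, aux_layer]

lemma aux_g_anti (φ : ℝ → ENNReal) (hφ : Measurable φ)
    (ho : ∀ s, Set.OrdConnected {x | s < φ x}) (t t' : ℝ) (h0 : 0 ≤ t) (htt : t ≤ t') :
    ∫⁻ y, φ y * φ (y + t') ≤ ∫⁻ y, φ y * φ (y + t) := by
  rw [aux_g_eq φ hφ, aux_g_eq φ hφ]
  refine lintegral_mono fun p => ?_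
  rcases le_total p.1 p.2 with h | h
  · have e : ∀ u : ℝ, volume {y : ℝ | ENNReal.ofReal p.1 < φ y ∧ ENNReal.ofReal p.2 < φ (y + u)}
      = volume {y : ℝ | ENNReal.ofReal p.1 < φ (y - u) ∧ ENNReal.ofReal p.2 < φ y} := by
      intro u
      rw [← measure_preimage_add_right volume u {y : ℝ | ENNReal.ofReal p.1 < φ (y - u) ∧ ENNReal.ofReal p.2 < φ y}]
      simp
    simp only [e]
    refine measure_mono fun y hy => ⟨?_, hy.2⟩
    exact (ho _).out hy.1 (lt_of_le_of_lt (ENNReal.ofReal_le_ofReal h) hy.2)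
      ⟨by linarith, by linarith⟩
  · refine measure_mono fun y hy => ⟨hy.1, ?_⟩
    exact (ho _).out (lt_of_le_of_lt (ENNReal.ofReal_le_ofReal h) hy.1) hy.2
      ⟨by linarith, by linarith⟩

lemma aux_g_even (φ : ℝ → ENNReal) (t : ℝ) :
    ∫⁻ y, φ y * φ (y + -t) = ∫⁻ y, φ y * φ (y + t) := by
  rw [← lintegral_add_right_eq_self (fun y => φ y * φ (y + -t)) t]
  refine lintegral_congr fun y => ?_
  simp [mul_comm]

/-- law of the difference of independent variables -/
noncomputable def auxL (μ ν : Measure ℝ) : Measure ℝ := (μ.prod ν).map (fun p => p.1 - p.2)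

lemma auxL_lintegral (μ ν : Measure ℝ) [SFinite μ] [SFinite ν] (A : Set ℝ) (hA : MeasurableSet A) :
    auxL μ ν A = ∫⁻ x, ∫⁻ y, A.indicator 1 (x - y) ∂ν ∂μ := by
  have hm : Measurable (A.indicator (1 : ℝ → ENNReal)) := measurable_one.indicator hA
  rw [auxL, ← lintegral_indicator_one hA, lintegral_map hm (by fun_prop),
    lintegral_prod _ (by fun_prop)]

lemma aux_self (μ : Measure ℝ) [IsProbabilityMeasure μ] (m : ℝ) (h : IsUnimodalWithMode μ m) :
    IsUnimodalWithMode (auxL μ μ) 0 := by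
  obtain ⟨φ, h1, h2, hμ⟩ := aux_forward μ m h
  have ho := aux_ordConnected φ m h1 h2
  have hφ : Measurable φ := measurable_of_Ioi fun s => (ho s).measurableSet
  have : IsProbabilityMeasure (auxL μ μ) :=
    Measure.isProbabilityMeasure_map (by fun_prop)
  set c := μ {m} with hc
  have hg : Measurable fun t => ∫⁻ y, φ y * φ (y + t) :=
    Measurable.lintegral_prod_left' (f := fun p : ℝ × ℝ => φ p.1 * φ (p.1 + p.2)) (by fun_prop)
  refine aux_backward (auxL μ μ) (c * c)
    (fun t => (c * φ (m - t) + c * φ (m + t)) + ∫⁻ y, φ y * φ (y + t)) ?_ ?_ ?_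
  · intro x hx y hy hxy
    have hx' : x < 0 := hx
    have hy' : y < 0 := hy
    refine add_le_add (add_le_add ?_ ?_) ?_
    · exact mul_le_mul_right (h2 (by simp; linarith) (by simp; linarith) (by linarith)) _
    · exact mul_le_mul_right (h1 (by simp; linarith) (by simp; linarith) (by linarith)) _
    · rw [← aux_g_even φ x, ← aux_g_even φ y]
      exact aux_g_anti φ hφ ho _ _ (by linarith) (by linarith)
  · intro x hx y hy hxy
    have hx' : 0 < x := hx
    have hy' : 0 < y := hy
    refine add_le_add (add_le_add ?_ ?_) ?_
    · exact mul_le_mul_right (h1 (by simp; linarith) (by simp; linarith) (by linarith)) _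
    · exact mul_le_mul_right (h2 (by simp; linarith) (by simp; linarith) (by linarith)) _
    · exact aux_g_anti φ hφ ho _ _ (by linarith) (by linarith)
  · ext A hA
    have hm : Measurable (A.indicator (1 : ℝ → ENNReal)) := measurable_one.indicator hA
    have hI : ∀ ψ : ℝ → ENNReal, Measurable ψ → ∫⁻ x, ψ x ∂μ = c * ψ m + ∫⁻ x, φ x * ψ x := by
      intro ψ hψ
      conv_lhs => rw [hμ]
      rw [lintegral_add_measure, lintegral_smul_measure, lintegral_dirac' _ hψ,
        lintegral_withDensity_eq_lintegral_mul _ hφ hψ]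
      rfl
    have hsh : Measurable fun x => ∫⁻ y, φ y * A.indicator 1 (x - y) :=
      Measurable.lintegral_prod_right' (f := fun p : ℝ × ℝ => φ p.2 * A.indicator 1 (p.1 - p.2))
        (by fun_prop)
    rw [auxL_lintegral _ _ _ hA]
    have s1 : ∀ x, ∫⁻ y, A.indicator 1 (x - y) ∂μ
        = c * A.indicator 1 (x - m) + ∫⁻ y, φ y * A.indicator 1 (x - y) :=
      fun x => hI _ (by fun_prop)
    simp only [s1]
    rw [hI _ (by fun_prop)]
    have i1 : ∫⁻ y, φ y * A.indicator 1 (m - y) = ∫⁻ t, φ (m - t) * A.indicator 1 t := by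
      rw [← lintegral_sub_left_eq_self (fun y => φ y * A.indicator 1 (m - y)) m]
      simp
    have i2 : ∫⁻ x, φ x * A.indicator 1 (x - m) = ∫⁻ t, φ (m + t) * A.indicator 1 t := by
      rw [← lintegral_add_left_eq_self (fun y => φ y * A.indicator 1 (y - m)) m]
      simp
    have i3 : ∫⁻ x, φ x * ∫⁻ y, φ y * A.indicator 1 (x - y)
        = ∫⁻ t, (∫⁻ y, φ y * φ (y + t)) * A.indicator 1 t := by
      calc ∫⁻ x, φ x * ∫⁻ y, φ y * A.indicator 1 (x - y)
          = ∫⁻ x, ∫⁻ y, φ x * (φ y * A.indicator 1 (x - y)) :=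
            lintegral_congr fun x => (lintegral_const_mul _ (by fun_prop)).symm
        _ = ∫⁻ y, ∫⁻ x, φ x * (φ y * A.indicator 1 (x - y)) :=
            lintegral_lintegral_swap (by fun_prop)
        _ = ∫⁻ y, ∫⁻ t, φ (y + t) * (φ y * A.indicator 1 t) := by
            refine lintegral_congr fun y => ?_
            rw [← lintegral_add_left_eq_self _ y]
            simp
        _ = ∫⁻ t, ∫⁻ y, φ (y + t) * (φ y * A.indicator 1 t) :=
            lintegral_lintegral_swap (by fun_prop)
        _ = _ := by
            refine lintegral_congr fun t => ?_
            rw [← lintegral_mul_const _ (by fun_prop)]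
            refine lintegral_congr fun y => ?_
            ring
    have i4 : ∫⁻ x, φ x * (c * A.indicator 1 (x - m) + ∫⁻ y, φ y * A.indicator 1 (x - y))
        = c * (∫⁻ t, φ (m + t) * A.indicator 1 t)
          + ∫⁻ t, (∫⁻ y, φ y * φ (y + t)) * A.indicator 1 t := by
      rw [← i2, ← i3, ← lintegral_const_mul _ (by fun_prop), ← lintegral_add_left (by fun_prop)]
      refine lintegral_congr fun x => ?_
      ring
    rw [i4, i1, Measure.add_apply, withDensity_apply _ hA, ← lintegral_indicator hA]
    have i5 : ∫⁻ t, A.indicator (fun t => (c * φ (m - t) + c * φ (m + t)) + ∫⁻ y, φ y * φ (y + t)) t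
        = c * (∫⁻ t, φ (m - t) * A.indicator 1 t) + c * (∫⁻ t, φ (m + t) * A.indicator 1 t)
          + ∫⁻ t, (∫⁻ y, φ y * φ (y + t)) * A.indicator 1 t := by
      rw [← lintegral_const_mul _ (by fun_prop), ← lintegral_const_mul _ (by fun_prop),
        ← lintegral_add_left (by fun_prop), ← lintegral_add_left (by fun_prop)]
      refine lintegral_congr fun x => ?_
      by_cases hx : x ∈ A <;> simp [hx]
    rw [i5, Measure.smul_apply, Measure.dirac_apply' _ hA, sub_self, smul_eq_mul]
    ring

lemma auxL_prob (μ ν : Measure ℝ) [IsProbabilityMeasure μ] [IsProbabilityMeasure ν] :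
    IsProbabilityMeasure (auxL μ ν) :=
  Measure.isProbabilityMeasure_map (by fun_prop)

lemma auxL_symm (μ ν : Measure ℝ) [IsProbabilityMeasure μ] [IsProbabilityMeasure ν] :
    (auxL μ ν).map (fun x => -x) = auxL ν μ := by
  unfold auxL
  rw [Measure.map_map (by fun_prop) (by fun_prop), ← Measure.prod_swap (μ := μ) (ν := ν),
    Measure.map_map (by fun_prop) (by fun_prop)]
  congr 1
  ext p
  simp

lemma aux_mix_prob {ι : Type*} [Fintype ι] (w : ι → ℝ) (hw : ∀ i, 0 ≤ w i) (hs : ∑ i, w i = 1)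
    (ρ : ι → Measure ℝ) (hρ : ∀ i, IsProbabilityMeasure (ρ i)) :
    IsProbabilityMeasure (∑ i, ENNReal.ofReal (w i) • ρ i) := by
  constructor
  rw [Measure.finsetSum_apply]
  simp only [Measure.smul_apply, measure_univ, smul_eq_mul, mul_one]
  rw [← ENNReal.ofReal_sum_of_nonneg (fun i _ => hw i), hs, ENNReal.ofReal_one]

lemma aux_mix_unimodal {ι : Type*} [Fintype ι] (w : ι → ℝ) (hw : ∀ i, 0 ≤ w i)
    (hs : ∑ i, w i = 1)
    (ρ : ι → Measure ℝ) (hρ : ∀ i, IsProbabilityMeasure (ρ i))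
    (hu : ∀ i, IsUnimodalWithMode (ρ i) 0) :
    IsUnimodalWithMode (∑ i, ENNReal.ofReal (w i) • ρ i) 0 := by
  have := aux_mix_prob w hw hs ρ hρ
  have e : ∀ x, cdf (∑ i, ENNReal.ofReal (w i) • ρ i) x = ∑ i, w i * cdf (ρ i) x := by
    intro x
    rw [cdf_eq_real, measureReal_def, Measure.finsetSum_apply, ENNReal.toReal_sum]
    · refine Finset.sum_congr rfl fun i _ => ?_
      rw [cdf_eq_real, measureReal_def, Measure.smul_apply, smul_eq_mul, ENNReal.toReal_mul,
        ENNReal.toReal_ofReal (hw i)]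
    · intro i _
      exact ENNReal.mul_ne_top ENNReal.ofReal_ne_top (measure_ne_top _ _)
  constructor
  · refine ⟨convex_Iic 0, fun x hx y hy a b ha hb hab => ?_⟩
    simp only [e, smul_eq_mul, Finset.mul_sum]
    rw [← Finset.sum_add_distrib]
    refine Finset.sum_le_sum fun i _ => ?_
    have := mul_le_mul_of_nonneg_left ((hu i).1.2 hx hy ha hb hab) (hw i)
    simp only [smul_eq_mul] at this
    linarith
  · refine ⟨convex_Ici 0, fun x hx y hy a b ha hb hab => ?_⟩
    simp only [e, smul_eq_mul, Finset.mul_sum]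
    rw [← Finset.sum_add_distrib]
    refine Finset.sum_le_sum fun i _ => ?_
    have := mul_le_mul_of_nonneg_left ((hu i).2.2 hx hy ha hb hab) (hw i)
    simp only [smul_eq_mul] at this
    linarith

lemma aux_mix_map {ι : Type*} [Fintype ι] (w : ι → ℝ) (ρ : ι → Measure ℝ) :
    (∑ i, ENNReal.ofReal (w i) • ρ i).map (fun x => -x)
      = ∑ i, ENNReal.ofReal (w i) • (ρ i).map (fun x => -x) := by
  ext A hA
  rw [Measure.map_apply (by fun_prop) hA, Measure.finsetSum_apply, Measure.finsetSum_apply]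
  refine Finset.sum_congr rfl fun i _ => ?_
  rw [Measure.smul_apply, Measure.smul_apply, Measure.map_apply (by fun_prop) hA]

lemma auxL_sum {ι : Type*} [Fintype ι] (w : ι → ℝ) (hw : ∀ i, 0 ≤ w i) (hs : ∑ i, w i = 1)
    (ρ : ι → Measure ℝ) (hρ : ∀ i, IsProbabilityMeasure (ρ i)) :
    auxL (∑ i, ENNReal.ofReal (w i) • ρ i) (∑ i, ENNReal.ofReal (w i) • ρ i)
      = ∑ p : ι × ι, ENNReal.ofReal (w p.1 * w p.2) • auxL (ρ p.1) (ρ p.2) := by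
  have := aux_mix_prob w hw hs ρ hρ
  ext A hA
  have hm : Measurable (A.indicator (1 : ℝ → ENNReal)) := measurable_one.indicator hA
  rw [auxL_lintegral _ _ _ hA, Measure.finsetSum_apply, Fintype.sum_prod_type]
  simp only [lintegral_finsetSum_measure, lintegral_smul_measure, Measure.smul_apply]
  refine Finset.sum_congr rfl fun i _ => ?_
  have hmm : ∀ j, Measurable fun x => ∫⁻ y, A.indicator (1 : ℝ → ENNReal) (x - y) ∂(ρ j) := fun j =>
    Measurable.lintegral_prod_right' (f := fun p : ℝ × ℝ => A.indicator (1 : ℝ → ENNReal) (p.1 - p.2))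
        (by fun_prop)
  simp only [smul_eq_mul]
  rw [lintegral_finsetSum _ (fun j _ => (hmm j).const_mul _), Finset.mul_sum]
  refine Finset.sum_congr rfl fun j _ => ?_
  rw [lintegral_const_mul _ (hmm j), auxL_lintegral _ _ _ hA, ENNReal.ofReal_mul (hw i), mul_assoc]

/-- **The difference of two i.i.d. random variables whose common law is a finite mixture of
unimodal distributions is a mixture `π₀ ν₀ + (1 - π₀) ν₁` with `ν₀` symmetric about `0` and
unimodal with mode `0`, `ν₁` symmetric about `0`, and `π₀ = ∑ πᵢ² ≥ 1/K`.** -/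
theorem law_sub_indep_mixture_unimodal
    {Ω : Type*} [MeasurableSpace Ω] (P : Measure Ω) [IsProbabilityMeasure P]
    (K : ℕ) (hK : 1 ≤ K) (π : Fin K → ℝ) (hπ : ∀ i, 0 ≤ π i) (hπsum : ∑ i, π i = 1)
    (μ : Fin K → Measure ℝ) (hμprob : ∀ i, IsProbabilityMeasure (μ i))
    (m : Fin K → ℝ) (hμuni : ∀ i, IsUnimodalWithMode (μ i) (m i))
    (ε₁ ε₂ : Ω → ℝ) (hε₁ : Measurable ε₁) (hε₂ : Measurable ε₂)
    (hindep : IndepFun ε₁ ε₂ P)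
    (hlaw₁ : P.map ε₁ = ∑ i, ENNReal.ofReal (π i) • μ i)
    (hlaw₂ : P.map ε₂ = ∑ i, ENNReal.ofReal (π i) • μ i) :
    (1 : ℝ) / K ≤ ∑ i, (π i) ^ 2 ∧
      ∃ (ν₀ ν₁ : Measure ℝ), IsProbabilityMeasure ν₀ ∧ IsProbabilityMeasure ν₁ ∧
        IsSymmetricAboutZero ν₀ ∧ IsUnimodalWithMode ν₀ 0 ∧ IsSymmetricAboutZero ν₁ ∧
        P.map (fun ω => ε₁ ω - ε₂ ω) =
          ENNReal.ofReal (∑ i, (π i) ^ 2) • ν₀ +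
            ENNReal.ofReal (1 - ∑ i, (π i) ^ 2) • ν₁ := by

  have hKpos : (0 : ℝ) < K := by exact_mod_cast hK
  have hlow : (1 : ℝ) / K ≤ ∑ i, (π i) ^ 2 := by
    have := sq_sum_le_card_mul_sum_sq (s := Finset.univ) (f := π)
    rw [hπsum] at this
    simp only [Finset.card_univ, Fintype.card_fin] at this
    rw [div_le_iff₀ hKpos]
    linarith
  refine ⟨hlow, ?_⟩
  set q := ∑ i, (π i) ^ 2 with hq
  have hq0 : 0 < q := lt_of_lt_of_le (by positivity) hlow
  have hπ1 : ∀ i, π i ≤ 1 := fun i => by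
    rw [← hπsum]
    exact Finset.single_le_sum (fun j _ => hπ j) (Finset.mem_univ i)
  have hq1 : q ≤ 1 := by
    rw [hq, ← hπsum]
    refine Finset.sum_le_sum fun i _ => ?_
    nlinarith [hπ i, hπ1 i]
  have hlaw : P.map (fun ω => ε₁ ω - ε₂ ω)
      = ∑ p : Fin K × Fin K, ENNReal.ofReal (π p.1 * π p.2) • auxL (μ p.1) (μ p.2) := by
    rw [← auxL_sum π hπ hπsum μ hμprob, auxL]
    conv_rhs => rw [← hlaw₁]
    nth_rw 2 [hlaw₁]
    rw [← hlaw₂, ← (indepFun_iff_map_prod_eq_prod_map_map hε₁.aemeasurable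
      hε₂.aemeasurable).1 hindep, Measure.map_map (by fun_prop) (by fun_prop)]
    rfl
  have hLp : ∀ i j, IsProbabilityMeasure (auxL (μ i) (μ j)) := fun i j => auxL_prob _ _
  let w₀ : Fin K → ℝ := fun i => π i ^ 2 / q
  have hw₀ : ∀ i, 0 ≤ w₀ i := fun i => by positivity
  have hs₀ : ∑ i, w₀ i = 1 := by
    simp only [w₀]
    rw [← Finset.sum_div, ← hq, div_self hq0.ne']
  let o : Fin K × Fin K → ℝ := fun p => if p.1 = p.2 then 0 else π p.1 * π p.2
  have ho : ∀ p, 0 ≤ o p := fun p => by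
    simp only [o]; split_ifs
    · exact le_rfl
    · exact mul_nonneg (hπ _) (hπ _)
  have hdiag : ∀ (i : Fin K), ∑ j, (if i = j then π i * π j else 0) = π i ^ 2 := fun i => by
    simp [sq]
  have hso : ∑ p, o p = 1 - q := by
    have h1 : ∑ p : Fin K × Fin K, π p.1 * π p.2 = 1 := by
      rw [Fintype.sum_prod_type, ← Finset.sum_mul_sum, hπsum, one_mul]
    have h2 : ∑ p : Fin K × Fin K, (if p.1 = p.2 then π p.1 * π p.2 else 0) = q := by
      rw [Fintype.sum_prod_type]
      simp only [hdiag, hq]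
    rw [← h1, ← h2, ← Finset.sum_sub_distrib]
    refine Finset.sum_congr rfl fun p _ => ?_
    simp only [o]; split_ifs <;> simp
  have hsplit : ∑ p : Fin K × Fin K, ENNReal.ofReal (π p.1 * π p.2) • auxL (μ p.1) (μ p.2)
      = ENNReal.ofReal q • (∑ i, ENNReal.ofReal (w₀ i) • auxL (μ i) (μ i))
        + ∑ p : Fin K × Fin K, ENNReal.ofReal (o p) • auxL (μ p.1) (μ p.2) := by
    have h1 : ENNReal.ofReal q • (∑ i, ENNReal.ofReal (w₀ i) • auxL (μ i) (μ i))
        = ∑ p : Fin K × Fin K,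
          if p.1 = p.2 then ENNReal.ofReal (π p.1 * π p.2) • auxL (μ p.1) (μ p.2) else 0 := by
      rw [Finset.smul_sum, Fintype.sum_prod_type]
      refine Finset.sum_congr rfl fun i _ => ?_
      rw [Finset.sum_ite_eq, if_pos (Finset.mem_univ i), smul_smul, ← ENNReal.ofReal_mul hq0.le]
      congr 2
      simp only [w₀]
      field_simp
    rw [h1, ← Finset.sum_add_distrib]
    refine Finset.sum_congr rfl fun p _ => ?_
    simp only [o]; split_ifs <;> simp
  have hosym : (∑ p : Fin K × Fin K, ENNReal.ofReal (o p) • auxL (μ p.1) (μ p.2)).map (fun x => -x)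
      = ∑ p : Fin K × Fin K, ENNReal.ofReal (o p) • auxL (μ p.1) (μ p.2) := by
    rw [aux_mix_map o (fun p => auxL (μ p.1) (μ p.2))]
    simp only [auxL_symm]
    refine Fintype.sum_equiv (Equiv.prodComm _ _) _ _ fun p => ?_
    simp only [Equiv.prodComm_apply, Prod.fst_swap, Prod.snd_swap, o, eq_comm (a := p.2), mul_comm]
  refine ⟨∑ i, ENNReal.ofReal (w₀ i) • auxL (μ i) (μ i), ?_⟩
  have hp₀ := aux_mix_prob w₀ hw₀ hs₀ (fun i => auxL (μ i) (μ i)) (fun i => hLp i i)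
  have hsym₀ : IsSymmetricAboutZero (∑ i, ENNReal.ofReal (w₀ i) • auxL (μ i) (μ i)) := by
    unfold IsSymmetricAboutZero
    rw [aux_mix_map w₀ (fun i => auxL (μ i) (μ i))]
    simp only [auxL_symm]
  have hun₀ := aux_mix_unimodal w₀ hw₀ hs₀ (fun i => auxL (μ i) (μ i)) (fun i => hLp i i)
    (fun i => aux_self (μ i) (m i) (hμuni i))
  rw [hlaw, hsplit]
  rcases eq_or_lt_of_le hq1 with h1 | h1
  · refine ⟨Measure.dirac 0, hp₀, inferInstance, hsym₀, hun₀, ?_, ?_⟩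
    · unfold IsSymmetricAboutZero
      rw [Measure.map_dirac' (by fun_prop), neg_zero]
    · congr 1
      rw [h1, sub_self, ENNReal.ofReal_zero, zero_smul]
      refine Finset.sum_eq_zero fun p _ => ?_
      have : o p = 0 := by
        have h2 : ∑ p, o p = 0 := by rw [hso, h1, sub_self]
        exact (Finset.sum_eq_zero_iff_of_nonneg (fun p _ => ho p)).1 h2 p (Finset.mem_univ p)
      rw [this, ENNReal.ofReal_zero, zero_smul]
  · have hr : 0 < 1 - q := by linarith
    have hscale : ∀ p, ENNReal.ofReal (o p / (1 - q))
        = ENNReal.ofReal ((1 - q)⁻¹) * ENNReal.ofReal (o p) := fun p => by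
      rw [← ENNReal.ofReal_mul (by positivity), div_eq_inv_mul]
    have hfac : ∑ p : Fin K × Fin K, ENNReal.ofReal (o p / (1 - q)) • auxL (μ p.1) (μ p.2)
        = ENNReal.ofReal ((1 - q)⁻¹) •
          ∑ p : Fin K × Fin K, ENNReal.ofReal (o p) • auxL (μ p.1) (μ p.2) := by
      simp only [Finset.smul_sum, smul_smul, hscale]
    refine ⟨∑ p : Fin K × Fin K, ENNReal.ofReal (o p / (1 - q)) • auxL (μ p.1) (μ p.2), hp₀,
      aux_mix_prob (fun p => o p / (1 - q)) (fun p => div_nonneg (ho p) hr.le)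
        (by rw [← Finset.sum_div, hso, div_self hr.ne']) (fun p => auxL (μ p.1) (μ p.2))
        (fun p => hLp _ _), hsym₀, hun₀, ?_, ?_⟩
    · unfold IsSymmetricAboutZero
      rw [hfac, Measure.map_smul, hosym]
    · rw [hfac, smul_smul, ← ENNReal.ofReal_mul hr.le, mul_inv_cancel₀ hr.ne', ENNReal.ofReal_one,
        one_smul]
end
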